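/- Let A be a Banach algebra and φ ∈ Δ(A). If A is φ-biflat, then A is approximately left φ-biprojective. -/

import Mathlib

open Filter Topology

universe u

/-! ## Nets indexed by directed sets -/

/-- A (nonempty) directed index type, used to index nets. -/
structure DirSys : Type (u + 1) where
  ι : Type u
  [pre : Preorder ι]
  [dir : IsDirected ι (· ≤ ·)]
  [ne : Nonempty ι]

attribute [instance] DirSys.pre DirSys.dir DirSys.ne

section Core

variable (A : Type u) [NonUnitalNormedRing A] [NormedSpace ℂ A]
  [IsScalarTower ℂ A A] [SMulCommClass ℂ A A]

/-- A realization of the projective tensor product `A ⊗̂ A` of a Banach algebra `A` with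
itself, together with its canonical Banach `A`-bimodule structure and the product
(diagonal) map `π_A`.  The field `universal` is the universal property of the projective
tensor norm, which pins the object down uniquely up to isometric isomorphism. -/
structure ProjTensorSq (X : Type u) [NormedAddCommGroup X] [NormedSpace ℂ X]
    [CompleteSpace X] : Type (u + 1) where
  /-- the canonical bilinear map `(a, b) ↦ a ⊗ b` -/
  tmul : A →L[ℂ] A →L[ℂ] X
  /-- the projective norm is a cross norm -/
  norm_tmul : ∀ a b : A, ‖tmul a b‖ = ‖a‖ * ‖b‖
  /-- elementary tensors span a dense subspace -/
  dense_span : Dense (Submodule.span ℂ (Set.range fun p : A × A => tmul p.1 p.2) : Set X)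
  /-- the universal property of the projective tensor product -/
  universal : ∀ (Y : Type u) [NormedAddCommGroup Y] [NormedSpace ℂ Y] [CompleteSpace Y]
      (f : A →L[ℂ] A →L[ℂ] Y), ∃ g : X →L[ℂ] Y, ‖g‖ ≤ ‖f‖ ∧ ∀ a b : A, g (tmul a b) = f a b
  /-- the left module action `a · (b ⊗ c) = (a * b) ⊗ c` -/
  lsmul : A →L[ℂ] X →L[ℂ] X
  lsmul_tmul : ∀ a b c : A, lsmul a (tmul b c) = tmul (a * b) c
  /-- the right module action `(b ⊗ c) · a = b ⊗ (c * a)` -/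
  rsmul : A →L[ℂ] X →L[ℂ] X
  rsmul_tmul : ∀ a b c : A, rsmul a (tmul b c) = tmul b (c * a)
  /-- the product map `π_A`, determined by `π_A (a ⊗ b) = a * b` -/
  projL : X →L[ℂ] A
  projL_tmul : ∀ a b : A, projL (tmul a b) = a * b

variable {A}

/-- `A` is approximately left `φ`-biprojective:  there is a net `(ρ_α)` of bounded linear
maps `A → A ⊗̂ A` with `a·ρ_α(x) - ρ_α(ax) → 0`, `ρ_α(xa) - φ(a)ρ_α(x) → 0` and
`φ(π_A(ρ_α(x))) → φ(x)` for all `a x : A`. -/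
def ApproxLeftBiprojective (φ : WeakDual.characterSpace ℂ A) : Prop :=
  ∀ (X : Type u) [NormedAddCommGroup X] [NormedSpace ℂ X] [CompleteSpace X]
    (P : ProjTensorSq A X),
    ∃ (D : DirSys.{u}) (ρ : D.ι → (A →L[ℂ] X)),
      (∀ a x : A, Tendsto (fun i => P.lsmul a (ρ i x) - ρ i (a * x)) atTop (𝓝 0)) ∧
      (∀ a x : A, Tendsto (fun i => ρ i (x * a) - φ a • ρ i x) atTop (𝓝 0)) ∧
      (∀ x : A, Tendsto (fun i => φ (P.projL (ρ i x))) atTop (𝓝 (φ x)))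

/-- `A` is approximately left character biprojective if it is approximately left
`φ`-biprojective for every character `φ` of `A`. -/
def ApproxLeftCharBiprojective : Prop :=
  ∀ φ : WeakDual.characterSpace ℂ A, ApproxLeftBiprojective φ

/-- `A` is approximately left `φ`-amenable: there is a (not necessarily bounded) net
`(a_α)` in `A` with `‖a * a_α - φ(a) a_α‖ → 0` for every `a` and `φ(a_α) → 1`. -/
def ApproxLeftAmenable (φ : WeakDual.characterSpace ℂ A) : Prop :=
  ∃ (D : DirSys.{u}) (v : D.ι → A),
    (∀ a : A, Tendsto (fun i => a * v i - φ a • v i) atTop (𝓝 0)) ∧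
    Tendsto (fun i => φ (v i)) atTop (𝓝 1)

/-- `A` is approximately biprojective (Zhang): there is a net `(ρ_α)` of bounded
`A`-bimodule morphisms `A → A ⊗̂ A` with `π_A(ρ_α(a)) → a` for every `a`. -/
def ApproxBiprojective : Prop :=
  ∀ (X : Type u) [NormedAddCommGroup X] [NormedSpace ℂ X] [CompleteSpace X]
    (P : ProjTensorSq A X),
    ∃ (D : DirSys.{u}) (ρ : D.ι → (A →L[ℂ] X)),
      (∀ i, ∀ a b : A, ρ i (a * b) = P.lsmul a (ρ i b)) ∧
      (∀ i, ∀ a b : A, ρ i (a * b) = P.rsmul b (ρ i a)) ∧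
      (∀ a : A, Tendsto (fun i => P.projL (ρ i a)) atTop (𝓝 a))

/-- `A` is pseudo-amenable: there is a (not necessarily bounded) net `(m_α)` in `A ⊗̂ A`
with `a·m_α - m_α·a → 0` and `π_A(m_α) a → a` for every `a`. -/
def PseudoAmenable : Prop :=
  ∀ (X : Type u) [NormedAddCommGroup X] [NormedSpace ℂ X] [CompleteSpace X]
    (P : ProjTensorSq A X),
    ∃ (D : DirSys.{u}) (m : D.ι → X),
      (∀ a : A, Tendsto (fun i => P.lsmul a (m i) - P.rsmul a (m i)) atTop (𝓝 0)) ∧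
      (∀ a : A, Tendsto (fun i => P.projL (m i) * a - a) atTop (𝓝 0))

end Core

section Biflat

variable {A : Type u} [NonUnitalNormedRing A] [NormedSpace ℂ A]
  [IsScalarTower ℂ A A] [SMulCommClass ℂ A A]

/-- A character, viewed as a bounded linear functional. -/
def charCLM (φ : WeakDual.characterSpace ℂ A) : A →L[ℂ] ℂ := φ.1

/-- The operator on the dual space induced by precomposition with a bounded operator. -/
noncomputable def dualOp {X : Type u} [NormedAddCommGroup X] [NormedSpace ℂ X]
    (T : X →L[ℂ] X) : (X →L[ℂ] ℂ) →L[ℂ] (X →L[ℂ] ℂ) :=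
  (ContinuousLinearMap.compL ℂ X X ℂ).flip T

/-- `A` is `φ`-biflat: there is a bounded `A`-bimodule morphism `ρ : A → (A ⊗̂ A)**`
(the bidual carrying the canonical bimodule structure) such that
`φ̃ (π_A** (ρ a)) = φ a` for every `a ∈ A`; the last condition unravels to
`ρ a (φ ∘ π_A) = φ a`. -/
def PhiBiflat (φ : WeakDual.characterSpace ℂ A) : Prop :=
  ∀ (X : Type u) [NormedAddCommGroup X] [NormedSpace ℂ X] [CompleteSpace X]
    (P : ProjTensorSq A X),
    ∃ ρ : A →L[ℂ] ((X →L[ℂ] ℂ) →L[ℂ] ℂ),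
      (∀ a b : A, ρ (a * b) = (ρ b).comp (dualOp (P.lsmul a))) ∧
      (∀ a b : A, ρ (a * b) = (ρ a).comp (dualOp (P.rsmul b))) ∧
      (∀ a : A, ρ a ((charCLM φ).comp P.projL) = φ a)

end Biflat

/-- **Hahn–Banach**: a vector on which every functional annihilating the subspace `p` vanishes
lies in the closure of `p`. -/
theorem Submodule.mem_closure_of_forall_dual {𝕜 E : Type*} [RCLike 𝕜] [NormedAddCommGroup E]
    [NormedSpace 𝕜 E] (p : Submodule 𝕜 E) (x : E)
    (h : ∀ g : E →L[𝕜] 𝕜, (∀ y ∈ p, g y = 0) → g x = 0) : x ∈ closure (p : Set E) := by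
  by_contra hx
  have hx' : p.topologicalClosure.mkQ x ≠ 0 := fun h0 =>
    hx ((Submodule.Quotient.mk_eq_zero _).1 h0)
  have : IsClosed (p.topologicalClosure : Set E) := p.isClosed_topologicalClosure
  obtain ⟨f, hf⟩ := SeparatingDual.exists_ne_zero (R := 𝕜) hx'
  refine hf (h (f.comp p.topologicalClosure.mkQL) fun y hy => ?_)
  have hy0 : p.topologicalClosure.mkQL y = 0 :=
    (Submodule.Quotient.mk_eq_zero _).2 (p.le_topologicalClosure hy)
  rw [ContinuousLinearMap.comp_apply, hy0, map_zero]

/-- If an element `m` of the bidual is annihilated by the second adjoints of finitely many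
operators `S i` and takes the value `1` at a functional `φ`, then some vector `v` satisfies these
relations approximately in norm. -/
theorem exists_norm_lt_of_bidual {𝕜 E F ι : Type*} [RCLike 𝕜] [NormedAddCommGroup E]
    [NormedSpace 𝕜 E] [NormedAddCommGroup F] [NormedSpace 𝕜 F] [Fintype ι]
    (S : ι → E →L[𝕜] F) (φ : E →L[𝕜] 𝕜) (m : (E →L[𝕜] 𝕜) →L[𝕜] 𝕜)
    (hS : ∀ i (f : F →L[𝕜] 𝕜), m (f.comp (S i)) = 0) (hφ : m φ = 1) {ε : ℝ} (hε : 0 < ε) :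
    ∃ v : E, (∀ i, ‖S i v‖ < ε) ∧ ‖φ v - 1‖ < ε := by
  classical
  let T : E →L[𝕜] (ι → F) × 𝕜 := (ContinuousLinearMap.pi S).prod φ
  have key : ((0, 1) : (ι → F) × 𝕜) ∈ closure (T.range : Set ((ι → F) × 𝕜)) := by
    refine Submodule.mem_closure_of_forall_dual _ _ fun g hg => ?_
    have hdecomp : (∑ i, (g.comp ((ContinuousLinearMap.inl 𝕜 (ι → F) 𝕜).comp
        (ContinuousLinearMap.single 𝕜 (fun _ => F) i))).comp (S i)) + g (0, 1) • φ = 0 := by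
      ext v
      have hv : T v = ∑ i, ((Pi.single i (S i v) : ι → F), (0 : 𝕜)) + φ v • (0, 1) := by
        refine Prod.ext ?_ ?_
        · simp [T, Prod.fst_sum, Finset.univ_sum_single]
        · simp [T, Prod.snd_sum]
      have h0 : g (T v) = 0 := hg _ ⟨v, rfl⟩
      rw [hv, map_add, map_sum, map_smul] at h0
      simpa [sum_apply, mul_comm] using h0
    have hm := congrArg m hdecomp
    simpa only [map_add, map_sum, hS, Finset.sum_const_zero, map_smul, hφ, map_zero, zero_add,
      smul_eq_mul, mul_one] using hm
  obtain ⟨_, ⟨v, rfl⟩, hv⟩ := Metric.mem_closure_iff.1 key ε hε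
  rw [dist_comm, dist_eq_norm] at hv
  have h1 := (norm_fst_le _).trans_lt hv
  refine ⟨v, fun i => ?_, (norm_snd_le _).trans_lt hv⟩
  simpa [T] using (norm_le_pi_norm _ i).trans_lt h1

section Slice

variable {A : Type u} [NonUnitalNormedRing A] [NormedSpace ℂ A]

namespace ProjTensorSq

variable {X : Type u} [NormedAddCommGroup X] [NormedSpace ℂ X] [CompleteSpace X]

/-- Bounded operators that agree on elementary tensors are equal. -/
theorem clm_ext (P : ProjTensorSq A X) {Y : Type*} [NormedAddCommGroup Y] [NormedSpace ℂ Y]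
    {f g : X →L[ℂ] Y} (h : ∀ a b : A, f (P.tmul a b) = g (P.tmul a b)) : f = g := by
  refine ContinuousLinearMap.ext_on P.dense_span ?_
  rintro _ ⟨p, rfl⟩
  exact h p.1 p.2

/-- The slice map `a ⊗ b ↦ φ b • a` exists. -/
theorem exists_slice [CompleteSpace A] (P : ProjTensorSq A X) (φ : A →L[ℂ] ℂ) :
    ∃ T : X →L[ℂ] A, ∀ a b : A, T (P.tmul a b) = φ b • a := by
  obtain ⟨T, -, hT⟩ := P.universal A
    ((ContinuousLinearMap.smulRightL ℂ A A) φ)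
  exact ⟨T, fun a b => by simp [hT]⟩

end ProjTensorSq

variable [IsScalarTower ℂ A A] [SMulCommClass ℂ A A]

/-- If `A` is `φ`-biflat, there is an element `m` of the bidual of `A` with `φ̃ m = 1` and
`(x * a) · m = φ a • x · m` for all `x a : A`. -/
theorem PhiBiflat.exists_bidual [CompleteSpace A] {φ : WeakDual.characterSpace ℂ A}
    (hbf : PhiBiflat φ) {X : Type u} [NormedAddCommGroup X] [NormedSpace ℂ X] [CompleteSpace X]
    (P : ProjTensorSq A X) {e : A} (he : φ e = 1) :
    ∃ m : (A →L[ℂ] ℂ) →L[ℂ] ℂ, m (charCLM φ) = 1 ∧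
      ∀ (x a : A) (f : A →L[ℂ] ℂ), m (f.comp (ContinuousLinearMap.mul ℂ A (x * a) -
        φ a • ContinuousLinearMap.mul ℂ A x)) = 0 := by
  obtain ⟨ρ, hl, hr, hφ⟩ := hbf X P
  obtain ⟨T, hT⟩ := P.exists_slice (charCLM φ)
  have hTl (x : A) : (ContinuousLinearMap.mul ℂ A x).comp T = T.comp (P.lsmul x) :=
    P.clm_ext fun a b => by simp [hT, P.lsmul_tmul]
  have hTr (x : A) : T.comp (P.rsmul x) = φ x • T :=
    P.clm_ext fun a b => by
      have : charCLM φ (b * x) = charCLM φ b * φ x := map_mul φ b x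
      simp [hT, P.rsmul_tmul, this, smul_smul, mul_comm]
  have hTφ : (charCLM φ).comp T = (charCLM φ).comp P.projL :=
    P.clm_ext fun a b => by
      have : charCLM φ (a * b) = charCLM φ a * charCLM φ b := map_mul φ a b
      simp [hT, P.projL_tmul, this, mul_comm]
  have hη (x b : A) (f : A →L[ℂ] ℂ) : ρ (x * b) (f.comp T) = φ b * ρ x (f.comp T) := by
    rw [hr, ContinuousLinearMap.comp_apply]
    have : dualOp (P.rsmul b) (f.comp T) = φ b • f.comp T := by
      change (f.comp T).comp (P.rsmul b) = _
      rw [ContinuousLinearMap.comp_assoc, hTr, ContinuousLinearMap.comp_smul]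
    rw [this, map_smul, smul_eq_mul]
  have hm (x : A) (f : A →L[ℂ] ℂ) :
      ρ e ((f.comp (ContinuousLinearMap.mul ℂ A x)).comp T) = ρ x (f.comp T) := by
    have : (f.comp (ContinuousLinearMap.mul ℂ A x)).comp T =
        dualOp (P.lsmul x) (f.comp T) := by
      change _ = (f.comp T).comp (P.lsmul x)
      rw [ContinuousLinearMap.comp_assoc, hTl, ContinuousLinearMap.comp_assoc]
    rw [this, ← ContinuousLinearMap.comp_apply, ← hl, hη, he, one_mul]
  refine ⟨(ρ e).comp ((ContinuousLinearMap.compL ℂ X A ℂ).flip T), ?_, fun x a f => ?_⟩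
  · change ρ e ((charCLM φ).comp T) = 1
    rw [hTφ, hφ, he]
  · change ρ e ((f.comp _).comp T) = 0
    rw [ContinuousLinearMap.comp_sub, ContinuousLinearMap.comp_smul,
      ContinuousLinearMap.sub_comp, ContinuousLinearMap.smul_comp, map_sub, map_smul, hm, hm, hη,
      smul_eq_mul, sub_self]

end Slice

/-- Theorem 2.6.  Let `A` be a Banach algebra and `φ ∈ Δ(A)`.
If `A` is `φ`-biflat, then `A` is approximately left `φ`-biprojective. -/
theorem phiBiflat_implies_approxLeftBiprojective
    {A : Type u} [NonUnitalNormedRing A] [NormedSpace ℂ A]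
    [IsScalarTower ℂ A A] [SMulCommClass ℂ A A] [CompleteSpace A]
    (φ : WeakDual.characterSpace ℂ A)
    (hbf : PhiBiflat φ) :
    ApproxLeftBiprojective φ := by
  classical
  intro X _ _ _ P
  obtain ⟨e, he⟩ : ∃ e : A, φ e = 1 := by
    obtain ⟨b, hb⟩ : ∃ b : A, φ b ≠ 0 := by
      by_contra! h
      exact φ.2.1 (DFunLike.ext _ _ h)
    exact ⟨(φ b)⁻¹ • b, by rw [map_smul, smul_eq_mul, inv_mul_cancel₀ hb]⟩
  obtain ⟨m, hmφ, hm⟩ := hbf.exists_bidual P he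
  have hex (i : Finset (A × A) × ℕ) : ∃ v : A,
      (∀ p : i.1, ‖(ContinuousLinearMap.mul ℂ A (p.1.1 * p.1.2) -
        φ p.1.2 • ContinuousLinearMap.mul ℂ A p.1.1) v‖ < 1 / ((i.2 : ℝ) + 1)) ∧
      ‖charCLM φ v - 1‖ < 1 / ((i.2 : ℝ) + 1) :=
    exists_norm_lt_of_bidual _ _ m (fun p f => hm p.1.1 p.1.2 f) hmφ Nat.one_div_pos_of_nat
  choose v hv hvφ using hex
  have hlim : Tendsto (fun i : Finset (A × A) × ℕ => 1 / ((i.2 : ℝ) + 1)) atTop (𝓝 0) := by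
    rw [← prod_atTop_atTop_eq]
    exact tendsto_one_div_add_atTop_nhds_zero_nat.comp tendsto_snd
  have hmul (x a : A) : Tendsto (fun i => x * a * v i - φ a • (x * v i)) atTop (𝓝 0) := by
    refine squeeze_zero_norm' ?_ hlim
    filter_upwards [eventually_ge_atTop (({(x, a)}, 0) : Finset (A × A) × ℕ)] with i hi
    exact (hv i ⟨(x, a), Finset.singleton_subset_iff.1 hi.1⟩).le
  have hone : Tendsto (fun i => φ (v i)) atTop (𝓝 1) :=
    tendsto_iff_norm_sub_tendsto_zero.2 <|
      squeeze_zero (fun _ => norm_nonneg _) (fun i => (hvφ i).le) hlim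
  refine ⟨⟨Finset (A × A) × ℕ⟩, fun i =>
    (P.tmul.flip e).comp ((ContinuousLinearMap.mul ℂ A).flip (v i)), fun a x => ?_, fun a x => ?_,
    fun x => ?_⟩
  · simp [P.lsmul_tmul, mul_assoc]
  · have h := ((P.tmul.flip e).continuous.tendsto 0).comp (hmul x a)
    rw [map_zero] at h
    refine h.congr fun i => ?_
    simp
  · have h := hone.const_mul (φ x)
    rw [mul_one] at h
    refine h.congr fun i => ?_
    simp [P.projL_tmul, he]
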